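/- Let {X_n}_{n≥1} be a symmetric correlated random walk with delays on {1,0,-1} with parameters 0≤p,q,r<1, p+r≤1, started from the stationary distribution, and let S_n = X_1+···+X_n. Then with a = (2p+r-1)/(2-2p-r), the process M_n = S_n + a·X_n is a martingale with respect to the filtration F_n = σ(X_1,...,X_n). -/

import Mathlib

open MeasureTheory ProbabilityTheory Set

noncomputable section

variable {Ω : Type*} [MeasurableSpace Ω]

/-- The σ-algebra `σ(X_1, …, X_n)` generated by the first `n` steps of the process. -/
def sigmaUpTo (X : ℕ → Ω → ℝ) (n : ℕ) : MeasurableSpace Ω :=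
  ⨆ i ∈ Finset.Icc 1 n, MeasurableSpace.comap (X i) inferInstance

/-- The transition kernel of the symmetric correlated random walk with delays on
`{1, 0, -1}`: from state `1` the probabilities of `(1, 0, -1)` are `(p, r, 1-p-r)`;
from state `0` they are `((1-q)/2, q, (1-q)/2)`; from state `-1` they are
`(1-p-r, r, p)`. -/
def delayKernel (p q r : ℝ) (i j : ℝ) : ℝ :=
  if i = 1 then (if j = 1 then p else if j = 0 then r else 1 - p - r)
  else if i = 0 then (if j = 0 then q else (1 - q) / 2)
  else (if j = 1 then 1 - p - r else if j = 0 then r else p)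

/-- `X` is a symmetric correlated random walk with delays on `{1, 0, -1}` with
parameters `p, q, r`, started from the stationary distribution
`((1-q)/(2(1+r-q)), r/(1+r-q), (1-q)/(2(1+r-q)))`: each `X n` (for `n ≥ 1`) is
measurable with values in `{1, 0, -1}`, the initial distribution is stationary,
and the Markov property with the prescribed time-homogeneous transition
probabilities holds, conditionally on `F n = σ(X_1, …, X_n)`. -/
def IsDelayedCRW (μ : Measure Ω) (X : ℕ → Ω → ℝ) (p q r : ℝ) : Prop :=
  (∀ i, 1 ≤ i → Measurable (X i)) ∧
  (∀ n, 1 ≤ n → ∀ ω, X n ω = 1 ∨ X n ω = 0 ∨ X n ω = -1) ∧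
  (μ {ω | X 1 ω = 1} = ENNReal.ofReal ((1 - q) / (2 * (1 + r - q)))) ∧
  (μ {ω | X 1 ω = 0} = ENNReal.ofReal (r / (1 + r - q))) ∧
  (∀ n, 1 ≤ n → ∀ i ∈ ({1, 0, -1} : Set ℝ), ∀ j ∈ ({1, 0, -1} : Set ℝ),
    ∀ E : Set Ω, MeasurableSet[sigmaUpTo X n] E →
      μ (E ∩ {ω | X n ω = i ∧ X (n + 1) ω = j})
        = ENNReal.ofReal (delayKernel p q r i j) * μ (E ∩ {ω | X n ω = i}))

/-- The natural filtration `F_{k+1} = σ(X_1, …, X_{k+1})`, shifted so that the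
index `k : ℕ` corresponds to time `k + 1` (processes in the paper start at time 1). -/
def crwFiltration (X : ℕ → Ω → ℝ) (hX : ∀ i, 1 ≤ i → Measurable (X i)) :
    Filtration ℕ (inferInstance : MeasurableSpace Ω) where
  seq k := sigmaUpTo X (k + 1)
  mono' a b hab := by
    refine biSup_mono fun i hi => ?_
    simp only [Finset.mem_Icc] at *
    omega
  le' k := iSup₂_le fun i hi => (hX i (Finset.mem_Icc.mp hi).1).comap_le

lemma measurable_sigmaUpTo {α : Type*} (X : ℕ → α → ℝ) {i n : ℕ} (hi : 1 ≤ i) (hin : i ≤ n) :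
    Measurable[sigmaUpTo X n] (X i) :=
  measurable_iff_comap_le.mpr <|
    le_iSup₂_of_le (f := fun i _ => MeasurableSpace.comap (X i) inferInstance)
      i (Finset.mem_Icc.mpr ⟨hi, hin⟩) le_rfl

lemma integrable_of_mem_signs {μ : Measure Ω} [IsFiniteMeasure μ] {Y : Ω → ℝ} (hY : Measurable Y)
    (h : ∀ ω, Y ω = 1 ∨ Y ω = 0 ∨ Y ω = -1) : Integrable Y μ := by
  refine Integrable.of_bound hY.aestronglyMeasurable 1 (Filter.Eventually.of_forall fun ω => ?_)
  rcases h ω with h | h | h <;> simp [h]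

/-- The integral of a `{1, 0, -1}`-valued function is the difference of the measures of
the level sets of `1` and `-1`. -/
lemma setIntegral_of_mem_signs {μ : Measure Ω} [IsFiniteMeasure μ] {Y : Ω → ℝ}
    (hY : Measurable Y) (h : ∀ ω, Y ω = 1 ∨ Y ω = 0 ∨ Y ω = -1) (E : Set Ω) :
    ∫ ω in E, Y ω ∂μ = μ.real (E ∩ {ω | Y ω = 1}) - μ.real (E ∩ {ω | Y ω = -1}) := by
  have hm (c : ℝ) : MeasurableSet {ω | Y ω = c} := hY (measurableSet_singleton c)
  have hYeq : Y = fun ω => {ω | Y ω = 1}.indicator (fun _ => (1 : ℝ)) ω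
      - {ω | Y ω = -1}.indicator (fun _ => (1 : ℝ)) ω := by
    funext ω
    rcases h ω with h | h | h <;> norm_num [indicator, h]
  have key : ∫ ω in E, Y ω ∂μ = ∫ ω in E, ({ω | Y ω = 1}.indicator (fun _ => (1 : ℝ)) ω
      - {ω | Y ω = -1}.indicator (fun _ => (1 : ℝ)) ω) ∂μ :=
    congrArg (fun f : Ω → ℝ => ∫ ω in E, f ω ∂μ) hYeq
  rw [key, integral_sub ((integrable_const 1).indicator (hm 1))
    ((integrable_const 1).indicator (hm (-1))), integral_indicator_const _ (hm 1),
    integral_indicator_const _ (hm (-1)), measureReal_restrict_apply (hm 1),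
    measureReal_restrict_apply (hm (-1)), inter_comm, inter_comm _ E]
  simp

lemma measureReal_eq_add_add_of_mem_signs {μ : Measure Ω} [IsFiniteMeasure μ] {Y : Ω → ℝ}
    (hY : Measurable Y) (h : ∀ ω, Y ω = 1 ∨ Y ω = 0 ∨ Y ω = -1) (E F : Set Ω) :
    μ.real (E ∩ F) = μ.real (E ∩ {ω | Y ω = 1 ∧ ω ∈ F}) + μ.real (E ∩ {ω | Y ω = 0 ∧ ω ∈ F})
      + μ.real (E ∩ {ω | Y ω = -1 ∧ ω ∈ F}) := by
  have hm (c : ℝ) : MeasurableSet {ω | Y ω = c} := hY (measurableSet_singleton c)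
  rw [← measureReal_inter_add_sdiff (s := E ∩ F) (hm 1),
    ← measureReal_inter_add_sdiff (s := (E ∩ F) \ {ω | Y ω = 1}) (hm 0), ← add_assoc]
  refine congrArg₂ _ (congrArg₂ _ (congrArg _ ?_) (congrArg _ ?_)) (congrArg _ ?_) <;>
  · ext ω
    change _ ↔ ω ∈ E ∧ _ ∧ ω ∈ F
    rcases h ω with h | h | h <;> norm_num [h]

/-- One step of the walk multiplies the conditional mean by `2p + r - 1`. -/
lemma IsDelayedCRW.setIntegral_succ {μ : Measure Ω} [IsFiniteMeasure μ] {X : ℕ → Ω → ℝ}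
    {p q r : ℝ} (hX : IsDelayedCRW μ X p q r) (hp0 : 0 ≤ p) (hq1 : q ≤ 1) (hpr : p + r ≤ 1)
    {n : ℕ} (hn : 1 ≤ n) {E : Set Ω} (hE : MeasurableSet[sigmaUpTo X n] E) :
    ∫ ω in E, X (n + 1) ω ∂μ = (2 * p + r - 1) * ∫ ω in E, X n ω ∂μ := by
  obtain ⟨hmeas, hval, -, -, htrans⟩ := hX
  have hstep (i : ℝ) (hi : i ∈ ({1, 0, -1} : Set ℝ)) (j : ℝ) (hj : j ∈ ({1, 0, -1} : Set ℝ))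
      (hk : 0 ≤ delayKernel p q r i j) :
      μ.real (E ∩ {ω | X n ω = i ∧ ω ∈ {ω | X (n + 1) ω = j}})
        = delayKernel p q r i j * μ.real (E ∩ {ω | X n ω = i}) := by
    simp only [Measure.real, mem_ofPred_eq, htrans n hn i hi j hj E hE, ENNReal.toReal_mul,
      ENNReal.toReal_ofReal hk]
  rw [setIntegral_of_mem_signs (hmeas _ (by omega)) (hval _ (by omega)),
    setIntegral_of_mem_signs (hmeas _ hn) (hval _ hn),
    measureReal_eq_add_add_of_mem_signs (hmeas n hn) (hval n hn) E {ω | X (n + 1) ω = 1},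
    measureReal_eq_add_add_of_mem_signs (hmeas n hn) (hval n hn) E {ω | X (n + 1) ω = -1},
    hstep 1 (by simp) 1 (by simp) (by norm_num [delayKernel]; linarith),
    hstep 0 (by simp) 1 (by simp) (by norm_num [delayKernel]; linarith),
    hstep (-1) (by simp) 1 (by simp) (by norm_num [delayKernel]; linarith),
    hstep 1 (by simp) (-1) (by simp) (by norm_num [delayKernel]; linarith),
    hstep 0 (by simp) (-1) (by simp) (by norm_num [delayKernel]; linarith),
    hstep (-1) (by simp) (-1) (by simp) (by norm_num [delayKernel]; linarith)]
  norm_num [delayKernel]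
  ring

/-- For a symmetric CRW with delays started from the stationary distribution, with
`a = (2p+r-1)/(2-2p-r)`, the process `M_n = S_n + a·X_n` is a martingale with
respect to the natural filtration `F_n = σ(X_1, …, X_n)`. -/
theorem delayed_crw_additive_martingale
    (μ : Measure Ω) [IsProbabilityMeasure μ] (X : ℕ → Ω → ℝ) (p q r : ℝ)
    (hp0 : 0 ≤ p) (hp1 : p < 1) (hq0 : 0 ≤ q) (hq1 : q < 1)
    (hr0 : 0 ≤ r) (hr1 : r < 1) (hpr : p + r ≤ 1)
    (hX : IsDelayedCRW μ X p q r)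
    (S : ℕ → Ω → ℝ) (hS : ∀ n ω, S n ω = ∑ i ∈ Finset.Icc 1 n, X i ω)
    (a : ℝ) (ha : a = (2 * p + r - 1) / (2 - 2 * p - r)) :
    Martingale (fun k => fun ω => S (k + 1) ω + a * X (k + 1) ω)
      (crwFiltration X hX.1) μ := by
  obtain rfl : S = fun n ω => ∑ i ∈ Finset.Icc 1 n, X i ω := by
    funext n ω
    exact hS n ω
  have hint (n : ℕ) (hn : 1 ≤ n) : Integrable (X n) μ :=
    integrable_of_mem_signs (hX.1 n hn) (hX.2.1 n hn)
  have hintM (k : ℕ) :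
      Integrable (fun ω => ∑ i ∈ Finset.Icc 1 (k + 1), X i ω + a * X (k + 1) ω) μ :=
    (integrable_finsetSum _ fun i hi => hint i (Finset.mem_Icc.mp hi).1).add
      ((hint (k + 1) (by omega)).const_mul a)
  refine martingale_of_setIntegral_eq_succ (fun k => ?_) hintM fun k E hE => ?_
  · refine Measurable.stronglyMeasurable (Measurable.add ?_ ?_)
    · exact Finset.measurable_sum _ fun i hi =>
        measurable_sigmaUpTo X (Finset.mem_Icc.mp hi).1 (Finset.mem_Icc.mp hi).2
    · exact (measurable_sigmaUpTo X (by omega) le_rfl).const_mul a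
  · have hne : 2 - 2 * p - r ≠ 0 := by linarith
    have hcoef : (1 + a) * (2 * p + r - 1) = a := by
      have hmul : a * (2 - 2 * p - r) = 2 * p + r - 1 := by rw [ha, div_mul_cancel₀ _ hne]
      linear_combination -hmul
    have hsucc := hX.setIntegral_succ hp0 hq1.le hpr (n := k + 1) (by omega) hE
    have hcur := (hint (k + 1) (by omega)).integrableOn (s := E)
    have hnext := (hint (k + 1 + 1) (by omega)).integrableOn (s := E)
    have hdiff : ∀ ω, ∑ i ∈ Finset.Icc 1 (k + 1 + 1), X i ω + a * X (k + 1 + 1) ω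
        = (∑ i ∈ Finset.Icc 1 (k + 1), X i ω + a * X (k + 1) ω)
          + ((1 + a) * X (k + 1 + 1) ω - a * X (k + 1) ω) := fun ω => by
      rw [Finset.sum_Icc_succ_top (by omega)]
      ring
    simp only [hdiff]
    have hincr : IntegrableOn (fun ω => (1 + a) * X (k + 1 + 1) ω - a * X (k + 1) ω) E μ :=
      (hnext.const_mul _).sub (hcur.const_mul _)
    rw [integral_add (hintM k).integrableOn hincr,
      integral_sub (hnext.const_mul _) (hcur.const_mul _), integral_const_mul,
      integral_const_mul, hsucc, ← mul_assoc, hcoef, sub_self, add_zero]
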